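/- Let s ∈ [0, 1/2], ρ ≥ 2/9 + (5/9)s, and ε > 0. Then there exists a constant C > 0 such that for all f, g, h whose spacetime Fourier transforms are nonnegative (with ξ = ξ₁+ξ₂): (i) I_{m}(f̂,ĝ,ĥ) ≤ C ‖f‖_{Y_{0,ρ+ε}} ‖g‖_{L²(ℝ²)} ‖h‖_{X⁻_{0,1/2+ε}} with weight m(ξ₁,ξ₂) = |3ξ² − 2ξ₂|^{s}; (ii) I_{m}(f̂,ĝ,ĥ) ≤ C ‖f‖_{Y_{0,ρ+ε}} ‖g‖_{X_{0,1/2+ε}} ‖h‖_{L²(ℝ²)} with weight m(ξ₁,ξ₂) = |3ξ² + 2ξ₁|^{s}. -/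

import Mathlib

open MeasureTheory Real Set
open scoped ENNReal NNReal

noncomputable section

/-- Spacetime Fourier transform of `f : ℝ × ℝ → ℂ` (`p.1` = space frequency ξ, `p.2` = time frequency τ). -/
def FT2 (f : ℝ × ℝ → ℂ) : ℝ × ℝ → ℂ :=
  fun p => ∫ q : ℝ × ℝ,
    Complex.exp (-(2 * Real.pi * (q.1 * p.1 + q.2 * p.2)) * Complex.I) • f q

/-- Japanese bracket `⟨a⟩ = (1+a²)^{1/2}`. -/
def jb (a : ℝ) : ℝ := Real.sqrt (1 + a ^ 2)

/-- The Bourgain norm `‖f‖_{X_{s,b}(φ)}`, as an `ℝ≥0∞`-valued quantity. -/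
def XNorm (φ : ℝ → ℝ) (s b : ℝ) (f : ℝ × ℝ → ℂ) : ℝ≥0∞ :=
  (∫⁻ p : ℝ × ℝ,
    ENNReal.ofReal (jb p.1 ^ (2 * s) * jb (p.2 + φ p.1) ^ (2 * b) * ‖FT2 f p‖ ^ 2)) ^ (1/2 : ℝ)

/-- Schrödinger phase `φ(ξ) = ξ²`. -/
def SchPhase : ℝ → ℝ := fun ξ => ξ ^ 2

/-- Conjugate Schrödinger phase `φ(ξ) = -ξ²`. -/
def SchPhaseNeg : ℝ → ℝ := fun ξ => -ξ ^ 2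

/-- Airy (KdV) phase `φ(ξ) = -ξ³`. -/
def AiryPhase : ℝ → ℝ := fun ξ => -ξ ^ 3

/-- `f` has a nonnegative (real-valued) spacetime Fourier transform. -/
def HasNonnegFT (f : ℝ × ℝ → ℂ) : Prop :=
  ∀ p, (FT2 f p).im = 0 ∧ 0 ≤ (FT2 f p).re

/-- The weighted trilinear functional `I_m(f̂,ĝ,ĥ)`, applied here directly to
the Fourier transforms `F = f̂`, `G = ĝ`, `H = ĥ` (assumed nonnegative). -/
def Itri (m : ℝ → ℝ → ℝ) (F G H : ℝ × ℝ → ℂ) : ℝ≥0∞ :=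
  ∫⁻ q : (ℝ × ℝ) × (ℝ × ℝ),
    ENNReal.ofReal
      (m q.1.1 q.2.1 * (F (q.1.1 + q.2.1, q.1.2 + q.2.2)).re * (G q.1).re * (H q.2).re)

/-- Partial derivative in the spatial variable `x` (first coordinate). -/
def partialX (f : ℝ × ℝ → ℂ) : ℝ × ℝ → ℂ :=
  fun p => deriv (fun x => f (x, p.2)) p.1

/-- Multiplication by the rescaled time cutoff, `(ψ(t/δ)f)(x,t) = ψ(t/δ) f(x,t)`. -/
def timeCut (ψ : ℝ → ℝ) (δ : ℝ) (f : ℝ × ℝ → ℂ) : ℝ × ℝ → ℂ :=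
  fun p => (ψ (p.2 / δ) : ℂ) * f p

/-- `ψ` is a fixed even smooth bump, `0 ≤ ψ ≤ 1`, `ψ ≡ 1` on `[-1,1]`, supp ψ ⊆ `[-2,2]`. -/
def IsTimeBump (ψ : ℝ → ℝ) : Prop :=
  ContDiff ℝ (⊤ : ℕ∞) ψ ∧ HasCompactSupport ψ ∧ (∀ t, ψ (-t) = ψ t) ∧
  (∀ t, 0 ≤ ψ t ∧ ψ t ≤ 1) ∧ (∀ t ∈ Set.Icc (-1 : ℝ) 1, ψ t = 1) ∧
  Function.support ψ ⊆ Set.Icc (-2 : ℝ) 2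

/-- `m` is an admissible symbol `m_{N,s}` for the smoothing operator `I_{N,s}`. -/
def IsISymbol (N s : ℝ) (m : ℝ → ℝ) : Prop :=
  ContDiff ℝ (⊤ : ℕ∞) m ∧ (∀ ξ, m (-ξ) = m ξ) ∧
  (∀ ξ, 0 < m ξ ∧ m ξ ≤ 1) ∧
  (∀ ξ η, |ξ| ≤ |η| → m η ≤ m ξ) ∧
  (∀ ξ, |ξ| ≤ N → m ξ = 1) ∧
  (∀ ξ, 2 * N ≤ |ξ| → m ξ = N ^ (1 - s) * |ξ| ^ (s - 1))

/-- Inverse spacetime Fourier transform. -/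
def invFT2 (f : ℝ × ℝ → ℂ) : ℝ × ℝ → ℂ :=
  fun p => ∫ q : ℝ × ℝ,
    Complex.exp ((2 * Real.pi * (q.1 * p.1 + q.2 * p.2)) * Complex.I) • f q

/-- The Fourier multiplier operator (in `x`) with symbol `m(ξ)`. -/
def Iop (m : ℝ → ℝ) (f : ℝ × ℝ → ℂ) : ℝ × ℝ → ℂ :=
  invFT2 (fun q => (m q.1 : ℂ) * FT2 f q)

/-- The restricted Bourgain norm `‖f‖_{X^E_{s,b}(φ)}`. -/
def XRestNorm (φ : ℝ → ℝ) (s b : ℝ) (E : Set ℝ) (f : ℝ × ℝ → ℂ) : ℝ≥0∞ :=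
  ⨅ F ∈ {F : ℝ × ℝ → ℂ | XNorm φ s b F < ⊤ ∧ ∀ x t, t ∈ E → F (x, t) = f (x, t)},
    XNorm φ s b F


lemma jbInt {r : ℝ} (hr : 1 < r) :
    (∫⁻ x : ℝ, ENNReal.ofReal ((1 + x ^ 2) ^ (-r / 2))) < ⊤ := by
  have h := (integrable_rpow_neg_one_add_norm_sq (E := ℝ) (μ := volume) (r := r)
    (by simpa using hr)).lintegral_lt_top
  simpa using h

lemma mono_part {w : ℝ → ℝ≥0∞} {Q Q' : ℝ → ℝ} {S : Set ℝ} (hS : MeasurableSet S)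
    (hc : Convex ℝ S) (hQ : ∀ x, HasDerivAt Q (Q' x) x)
    (h : (∀ x ∈ S, 0 ≤ Q' x) ∨ (∀ x ∈ S, Q' x ≤ 0)) :
    ∫⁻ x in S, ENNReal.ofReal |Q' x| * w (Q x) ≤ ∫⁻ y, w y := by
  have hcont : Continuous Q := continuous_iff_continuousAt.2 fun x => (hQ x).continuousAt
  rcases h with h | h
  · have hm : MonotoneOn Q S := by
      apply monotoneOn_of_deriv_nonneg hc hcont.continuousOn
        (fun x _ => (hQ x).differentiableAt.differentiableWithinAt)
      intro x hx; rw [(hQ x).deriv]; exact h x (interior_subset hx)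
    have := lintegral_image_eq_lintegral_deriv_mul_of_monotoneOn hS
      (fun x _ => (hQ x).hasDerivWithinAt) hm w
    calc _ = ∫⁻ x in S, ENNReal.ofReal (Q' x) * w (Q x) := by
          apply setLIntegral_congr_fun hS
          intro x hx; simp only [abs_of_nonneg (h x hx)]
      _ = _ := this.symm
      _ ≤ _ := setLIntegral_le_lintegral _ _
  · have hm : AntitoneOn Q S := by
      apply antitoneOn_of_deriv_nonpos hc hcont.continuousOn
        (fun x _ => (hQ x).differentiableAt.differentiableWithinAt)
      intro x hx; rw [(hQ x).deriv]; exact h x (interior_subset hx)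
    have := lintegral_image_eq_lintegral_deriv_mul_of_antitoneOn hS
      (fun x _ => (hQ x).hasDerivWithinAt) hm w
    calc _ = ∫⁻ x in S, ENNReal.ofReal (-Q' x) * w (Q x) := by
          apply setLIntegral_congr_fun hS
          intro x hx; simp only [abs_of_nonpos (h x hx)]
      _ = _ := this.symm
      _ ≤ _ := setLIntegral_le_lintegral _ _

/-- Monic cubic with coefficients `a b c`. -/
def cub (a b c x : ℝ) : ℝ := x ^ 3 + a * x ^ 2 + b * x + c

lemma cub_deriv (a b c x : ℝ) : HasDerivAt (cub a b c) (3 * x ^ 2 + 2 * a * x + b) x := by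
  unfold cub
  have := ((((hasDerivAt_pow 3 x).add ((hasDerivAt_pow 2 x).const_mul a)).add
    ((hasDerivAt_id x).const_mul b)).add_const c)
  convert! this using 1
  simp; ring

lemma lemA (w : ℝ → ℝ≥0∞) (a b c : ℝ) :
    ∫⁻ x, ENNReal.ofReal |3 * x ^ 2 + 2 * a * x + b| * w (cub a b c x) ≤ 3 * ∫⁻ y, w y := by
  set J := fun x => ENNReal.ofReal |3 * x ^ 2 + 2 * a * x + b| * w (cub a b c x) with hJ
  have key : ∀ S : Set ℝ, MeasurableSet S → Convex ℝ S →
      ((∀ x ∈ S, 0 ≤ 3 * x ^ 2 + 2 * a * x + b) ∨ (∀ x ∈ S, 3 * x ^ 2 + 2 * a * x + b ≤ 0)) →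
      ∫⁻ x in S, J x ≤ ∫⁻ y, w y := fun S h1 h2 h3 => mono_part h1 h2 (cub_deriv a b c) h3
  by_cases he : 0 ≤ b - a ^ 2 / 3
  · have := key univ MeasurableSet.univ convex_univ
      (Or.inl fun x _ => by nlinarith [sq_nonneg (x + a / 3)])
    rw [Measure.restrict_univ] at this
    refine this.trans ?_
    calc _ = 1 * ∫⁻ y, w y := (one_mul _).symm
      _ ≤ _ := by gcongr; norm_num
  · push Not at he
    set d := √(-(b - a ^ 2 / 3) / 3) with hd
    have hd0 : 0 ≤ d := Real.sqrt_nonneg _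
    have hd2 : d ^ 2 = -(b - a ^ 2 / 3) / 3 := Real.sq_sqrt (by linarith)
    have fac : ∀ x, 3 * x ^ 2 + 2 * a * x + b = 3 * ((x + a / 3 - d) * (x + a / 3 + d)) := by
      intro x; nlinarith
    have h1 := key (Iic (-a / 3 - d)) measurableSet_Iic (convex_Iic _) (Or.inl fun x hx => by
      rw [fac]; rw [mem_Iic] at hx
      have := mul_nonneg_of_nonpos_of_nonpos (a := x + a/3 - d) (b := x + a/3+d) (by linarith) (by linarith)
      linarith)
    have h2 := key (Icc (-a / 3 - d) (-a / 3 + d)) measurableSet_Icc (convex_Icc _ _)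
      (Or.inr fun x hx => by
      rw [fac]; rw [mem_Icc] at hx
      have := mul_nonpos_of_nonpos_of_nonneg (a := x + a/3 - d) (b := x + a/3+d) (by linarith) (by linarith)
      linarith)
    have h3 := key (Ici (-a / 3 + d)) measurableSet_Ici (convex_Ici _) (Or.inl fun x hx => by
      rw [fac]; rw [mem_Ici] at hx
      have := mul_nonneg (a := x + a/3 - d) (b := x + a/3+d) (by linarith) (by linarith)
      linarith)
    have hU : (univ : Set ℝ) ⊆ (Iic (-a / 3 - d) ∪ Icc (-a / 3 - d) (-a / 3 + d)) ∪ Ici (-a / 3 + d) := by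
      intro x _
      simp only [mem_union, mem_Iic, mem_Icc, mem_Ici]
      grind
    calc ∫⁻ x, J x = ∫⁻ x in univ, J x := by rw [Measure.restrict_univ]
      _ ≤ ∫⁻ x in (Iic (-a / 3 - d) ∪ Icc (-a / 3 - d) (-a / 3 + d)) ∪ Ici (-a / 3 + d), J x :=
        lintegral_mono_set hU
      _ ≤ (∫⁻ x in Iic (-a / 3 - d), J x) + (∫⁻ x in Icc (-a / 3 - d) (-a / 3 + d), J x)
          + ∫⁻ x in Ici (-a / 3 + d), J x :=
        (lintegral_union_le _ _ _).trans (by gcongr; exact lintegral_union_le _ _ _)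
      _ ≤ (∫⁻ y, w y) + (∫⁻ y, w y) + ∫⁻ y, w y := by gcongr
      _ = _ := by ring

lemma cub_root (a b c : ℝ) : ∃ r, cub a b c r = 0 := by
  have hcont : Continuous (cub a b c) := continuous_iff_continuousAt.2 fun x => (cub_deriv a b c x).continuousAt
  set M := 1 + |a| + |b| + |c| with hM
  have ha := abs_nonneg a
  have hb := abs_nonneg b
  have hc := abs_nonneg c
  have hM1 : 1 ≤ M := by linarith
  have e1 : M ^ 3 = M ^ 2 + |a| * M ^ 2 + |b| * M ^ 2 + |c| * M ^ 2 := by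
    calc M ^ 3 = M * M ^ 2 := by ring
      _ = (1 + |a| + |b| + |c|) * M ^ 2 := by rw [← hM]
      _ = _ := by ring
  have hM2 : M ≤ M ^ 2 := by nlinarith
  have b1 : |b| * M ≤ |b| * M ^ 2 := by gcongr
  have c1 : |c| * 1 ≤ |c| * M ^ 2 := by gcongr; linarith
  have a2 : -(|a| * M ^ 2) ≤ a * M ^ 2 := by nlinarith [neg_abs_le a, sq_nonneg M]
  have a3 : a * M ^ 2 ≤ |a| * M ^ 2 := by nlinarith [le_abs_self a, sq_nonneg M]
  have b2 : -(|b| * M) ≤ b * M := by nlinarith [neg_abs_le b]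
  have b3 : b * M ≤ |b| * M := by nlinarith [le_abs_self b]
  have p1 : 0 ≤ cub a b c M := by
    unfold cub; nlinarith [neg_abs_le c]
  have p2 : cub a b c (-M) ≤ 0 := by
    unfold cub; nlinarith [le_abs_self c]
  obtain ⟨r, _, hr⟩ := intermediate_value_Icc (a := -M) (b := M) (by linarith) hcont.continuousOn ⟨p2, p1⟩
  exact ⟨r, hr⟩

lemma cub_lower (a b c : ℝ) : ∃ r₁ r₂ r₃ : ℝ, ∀ x,
    |x - r₁| * |x - r₂| * |x - r₃| ≤ |cub a b c x| := by
  obtain ⟨r, hr⟩ := cub_root a b c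
  have fac : ∀ x, cub a b c x = (x - r) * (x ^ 2 + (r + a) * x + (r ^ 2 + a * r + b)) := by
    intro x
    have : cub a b c x = cub a b c x - cub a b c r := by rw [hr]; ring
    rw [this]; unfold cub; ring
  set e := (r ^ 2 + a * r + b) - (r + a) ^ 2 / 4 with he
  by_cases h : 0 ≤ e
  · refine ⟨r, -(r + a) / 2, -(r + a) / 2, fun x => ?_⟩
    rw [fac, abs_mul, mul_assoc]
    gcongr
    rw [← abs_mul, abs_of_nonneg (mul_self_nonneg _)]
    refine le_trans ?_ (le_abs_self _)
    nlinarith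
  · push Not at h
    have hd2 : √(-e) ^ 2 = -e := Real.sq_sqrt (by linarith)
    refine ⟨r, -(r + a) / 2 - √(-e), -(r + a) / 2 + √(-e), fun x => ?_⟩
    rw [fac, ← abs_mul, ← abs_mul]
    apply le_of_eq
    congr 1
    rw [mul_assoc]; congr 1
    nlinarith

lemma lemB : ∃ K : ℝ≥0∞, K < ⊤ ∧ ∀ a b c : ℝ,
    ∫⁻ x, ENNReal.ofReal ((1 + cub a b c x ^ 2) ^ (-(2 / 9) : ℝ)) ≤ K := by
  set v : ℝ → ℝ≥0∞ := fun x => ENNReal.ofReal ((1 + (x ^ 3) ^ 2) ^ (-(2 / 9) : ℝ)) with hv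
  refine ⟨3 * ∫⁻ x, v x, ?_, ?_⟩
  · refine ENNReal.mul_lt_top (by norm_num) ?_
    have h := jbInt (r := 4 / 3) (by norm_num)
    refine lt_of_le_of_lt ?_ (ENNReal.mul_lt_top (ENNReal.ofReal_lt_top (r := (1/4) ^ (-(2 / 9) : ℝ))) h)
    rw [← lintegral_const_mul' _ _ ENNReal.ofReal_ne_top]
    refine lintegral_mono fun x => ?_
    simp only [hv]
    rw [← ENNReal.ofReal_mul (by positivity)]
    apply ENNReal.ofReal_le_ofReal
    have : ((1 + x ^ 2) ^ (-(4 / 3) / 2 : ℝ)) = ((1 + x ^ 2) ^ 3) ^ (-(2/9) : ℝ) := by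
      rw [← Real.rpow_natCast_mul (by positivity)]; norm_num
    rw [this, ← Real.mul_rpow (by positivity) (by positivity)]
    apply Real.rpow_le_rpow_of_nonpos (by positivity) _ (by norm_num)
    nlinarith [sq_nonneg (x^2 - 1), sq_nonneg x, mul_nonneg (sq_nonneg x) (sq_nonneg (x^2-1))]
  · intro a b c
    obtain ⟨r₁, r₂, r₃, hr⟩ := cub_lower a b c
    have hvm : Measurable v := by fun_prop
    have tr : ∀ r, ∫⁻ x, v (x - r) = ∫⁻ x, v x := fun r => lintegral_sub_right_eq_self v r
    have pt : ∀ r x, |x - r| ^ 3 ≤ |cub a b c x| →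
        ENNReal.ofReal ((1 + cub a b c x ^ 2) ^ (-(2 / 9) : ℝ)) ≤ v (x - r) := by
      intro r x h
      apply ENNReal.ofReal_le_ofReal
      apply Real.rpow_le_rpow_of_nonpos (by positivity) _ (by norm_num)
      rw [← abs_pow] at h
      have := sq_le_sq.2 h
      linarith
    calc _ ≤ ∫⁻ x, (v (x - r₁) + v (x - r₂) + v (x - r₃)) := by
          refine lintegral_mono fun x => ?_
          have h0 := hr x
          have p1 := abs_nonneg (x - r₁)
          have p2 := abs_nonneg (x - r₂)
          have p3 := abs_nonneg (x - r₃)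
          have cmp : ∀ t, 0 ≤ t → t ≤ |x - r₁| → t ≤ |x - r₂| → t ≤ |x - r₃| → t ^ 3 ≤ |cub a b c x| := by
            intro t h0 h1 h2 h3
            refine le_trans ?_ (hr x)
            calc t ^ 3 = t * t * t := by ring
              _ ≤ _ := by gcongr
          by_cases q1 : |x - r₁| ≤ |x - r₂| ∧ |x - r₁| ≤ |x - r₃|
          · exact (pt r₁ x (cmp _ p1 le_rfl q1.1 q1.2)).trans (by rw [add_assoc]; exact le_self_add)
          by_cases q2 : |x - r₂| ≤ |x - r₁| ∧ |x - r₂| ≤ |x - r₃|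
          · exact (pt r₂ x (cmp _ p2 q2.1 le_rfl q2.2)).trans (le_add_right le_add_self)
          · have : |x - r₃| ≤ |x - r₁| ∧ |x - r₃| ≤ |x - r₂| := by grind
            exact (pt r₃ x (cmp _ p3 this.1 this.2 le_rfl)).trans le_add_self
      _ = _ := by
          rw [lintegral_add_left (by fun_prop), lintegral_add_left (by fun_prop), tr, tr, tr]; ring

lemma lemC {s b ε : ℝ} (hs : s ∈ Set.Icc (0 : ℝ) (1/2)) (hε : 0 < ε)
    (hb : 2/9 + (5/9 : ℝ) * s + ε ≤ b) : ∃ K : ℝ≥0∞, K < ⊤ ∧ ∀ a₂ a₁ a₀ : ℝ,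
    ∫⁻ x, ENNReal.ofReal (|3 * x ^ 2 + 2 * a₂ * x + a₁| ^ (2 * s) *
      (1 + cub a₂ a₁ a₀ x ^ 2) ^ (-b)) ≤ K := by
  obtain ⟨KB, hKB, hB⟩ := lemB
  set w : ℝ → ℝ≥0∞ := fun y => ENNReal.ofReal ((1 + y ^ 2) ^ (-(1 + 2 * ε) / 2)) with hw
  have hwi : ∫⁻ y, w y < ⊤ := jbInt (by linarith)
  refine ⟨3 * (∫⁻ y, w y) + KB, ENNReal.add_lt_top.2 ⟨ENNReal.mul_lt_top (by norm_num) hwi, hKB⟩, ?_⟩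
  intro a₂ a₁ a₀
  have hA := lemA w a₂ a₁ a₀
  have hcont : Continuous (cub a₂ a₁ a₀) := continuous_iff_continuousAt.2 fun x => (cub_deriv _ _ _ x).continuousAt
  have hcm := hcont.measurable
  calc _ ≤ ∫⁻ x, (ENNReal.ofReal |3 * x ^ 2 + 2 * a₂ * x + a₁| * w (cub a₂ a₁ a₀ x) +
        ENNReal.ofReal ((1 + cub a₂ a₁ a₀ x ^ 2) ^ (-(2 / 9) : ℝ))) := by
        refine lintegral_mono fun x => ?_
        simp only [hw]
        set D := |3 * x ^ 2 + 2 * a₂ * x + a₁| with hD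
        have hD0 : 0 ≤ D := abs_nonneg _
        set W := 1 + cub a₂ a₁ a₀ x ^ 2 with hW
        have hW1 : 1 ≤ W := by nlinarith [sq_nonneg (cub a₂ a₁ a₀ x)]
        have hW0 : 0 < W := by linarith
        rw [← ENNReal.ofReal_mul hD0, ← ENNReal.ofReal_add (by positivity) (by positivity)]
        apply ENNReal.ofReal_le_ofReal
        obtain ⟨s0, s1⟩ := hs
        have amgm := Real.geom_mean_le_arith_mean2_weighted (w₁ := 2 * s) (w₂ := 1 - 2 * s)
          (p₁ := D * W ^ (-(1 + 2 * ε) / 2)) (p₂ := W ^ (-(2 / 9) : ℝ)) (by linarith) (by linarith)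
          (by positivity) (by positivity) (by ring)
        rw [Real.mul_rpow hD0 (by positivity), ← Real.rpow_mul hW0.le, ← Real.rpow_mul hW0.le,
          mul_assoc, ← Real.rpow_add hW0] at amgm
        have h1 : D ^ (2 * s) * W ^ (-b) ≤
            D ^ (2 * s) * W ^ (-(1 + 2 * ε) / 2 * (2 * s) + -(2 / 9) * (1 - 2 * s)) := by
          have : -b ≤ -(1 + 2 * ε) / 2 * (2 * s) + -(2 / 9) * (1 - 2 * s) := by nlinarith
          gcongr
        have p1 : 0 ≤ D * W ^ (-(1 + 2 * ε) / 2) := by positivity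
        have p2 : 0 ≤ W ^ (-(2 / 9) : ℝ) := by positivity
        nlinarith
    _ = (∫⁻ x, ENNReal.ofReal |3 * x ^ 2 + 2 * a₂ * x + a₁| * w (cub a₂ a₁ a₀ x)) +
        ∫⁻ x, ENNReal.ofReal ((1 + cub a₂ a₁ a₀ x ^ 2) ^ (-(2 / 9) : ℝ)) := by
        rw [lintegral_add_right]; fun_prop
    _ ≤ _ := by gcongr; exact hB _ _ _

lemma lemD {s b ε : ℝ} (σ : ℝ) (hs : s ∈ Set.Icc (0 : ℝ) (1/2)) (hε : 0 < ε)
    (hb : 2/9 + (5/9 : ℝ) * s + ε ≤ b) : ∃ K : ℝ≥0∞, K < ⊤ ∧ ∀ ξ τ : ℝ,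
    ∫⁻ p : ℝ × ℝ, ENNReal.ofReal (|3 * (ξ + p.1) ^ 2 - 2 * σ * p.1| ^ (2 * s) *
      (1 + (τ + p.2 - (ξ + p.1) ^ 3) ^ 2) ^ (-b)) *
      ENNReal.ofReal ((1 + (p.2 - σ * p.1 ^ 2) ^ 2) ^ (-(1 + 2 * ε) / 2)) ≤ K := by
  obtain ⟨K, hK, hC⟩ := lemC hs hε hb
  have hwi := jbInt (r := 1 + 2 * ε) (by linarith)
  refine ⟨K * _, ENNReal.mul_lt_top hK hwi, ?_⟩
  intro ξ τ
  have m1 : Measurable fun p : ℝ × ℝ => ENNReal.ofReal (|3 * (ξ + p.1) ^ 2 - 2 * σ * p.1| ^ (2 * s) *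
      (1 + (τ + p.2 - (ξ + p.1) ^ 3) ^ 2) ^ (-b)) *
      ENNReal.ofReal ((1 + (p.2 - σ * p.1 ^ 2) ^ 2) ^ (-(1 + 2 * ε) / 2)) := by fun_prop
  rw [Measure.volume_eq_prod, lintegral_prod _ m1.aemeasurable]
  simp only
  have step : ∀ x : ℝ, (∫⁻ y : ℝ, ENNReal.ofReal (|3 * (ξ + x) ^ 2 - 2 * σ * x| ^ (2 * s) *
      (1 + (τ + y - (ξ + x) ^ 3) ^ 2) ^ (-b)) *
      ENNReal.ofReal ((1 + (y - σ * x ^ 2) ^ 2) ^ (-(1 + 2 * ε) / 2))) =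
      ∫⁻ y : ℝ, ENNReal.ofReal (|3 * (ξ + x) ^ 2 - 2 * σ * x| ^ (2 * s) *
      (1 + (τ + (y + σ * x ^ 2) - (ξ + x) ^ 3) ^ 2) ^ (-b)) *
      ENNReal.ofReal ((1 + y ^ 2) ^ (-(1 + 2 * ε) / 2)) := by
    intro x
    rw [← lintegral_add_right_eq_self _ (σ * x ^ 2)]
    simp
  simp_rw [step]
  have m2 : Measurable fun p : ℝ × ℝ => ENNReal.ofReal (|3 * (ξ + p.1) ^ 2 - 2 * σ * p.1| ^ (2 * s) *
      (1 + (τ + (p.2 + σ * p.1 ^ 2) - (ξ + p.1) ^ 3) ^ 2) ^ (-b)) *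
      ENNReal.ofReal ((1 + p.2 ^ 2) ^ (-(1 + 2 * ε) / 2)) := by fun_prop
  rw [lintegral_lintegral_swap m2.aemeasurable]
  rw [← lintegral_const_mul' _ _ hK.ne]
  refine lintegral_mono fun y => ?_
  simp only
  rw [lintegral_mul_const' _ _ ENNReal.ofReal_ne_top]
  gcongr
  refine le_trans (le_of_eq ?_) (hC (3 * ξ - σ) (3 * ξ ^ 2) (ξ ^ 3 - τ - y))
  refine lintegral_congr fun x => ?_
  congr 4
  · ring_nf
  · unfold cub; ring_nf

lemma jb_pos (x : ℝ) : 0 < jb x := by unfold jb; positivity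

lemma jb_cont : Continuous jb := by unfold jb; fun_prop

lemma jb_rpow (x r : ℝ) : jb x ^ r = (1 + x ^ 2) ^ (r / 2) := by
  unfold jb
  rw [Real.sqrt_eq_rpow, ← Real.rpow_mul (by positivity)]
  ring_nf

lemma lemE {s b ε : ℝ} (σ : ℝ) (hs : s ∈ Set.Icc (0 : ℝ) (1/2)) (hε : 0 < ε)
    (hb : 2/9 + (5/9 : ℝ) * s + ε ≤ b) : ∃ C : ℝ≥0∞, C < ⊤ ∧
    ∀ F G H : ℝ × ℝ → ℝ≥0∞, Measurable F → Measurable G → Measurable H →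
    ∫⁻ q : (ℝ × ℝ) × (ℝ × ℝ), ENNReal.ofReal (|3 * (q.1.1 + q.2.1) ^ 2 - 2 * σ * q.2.1| ^ s) *
      F (q.1 + q.2) * G q.1 * H q.2 ≤
    C * (∫⁻ p, ENNReal.ofReal (jb (p.2 - p.1 ^ 3) ^ (2 * b)) * F p ^ 2) ^ (1/2 : ℝ) *
      (∫⁻ p, G p ^ 2) ^ (1/2 : ℝ) *
      (∫⁻ p, ENNReal.ofReal (jb (p.2 - σ * p.1 ^ 2) ^ (2 * (1/2 + ε))) * H p ^ 2) ^ (1/2 : ℝ) := by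
  obtain ⟨K, hK, hD⟩ := lemD σ hs hε hb
  refine ⟨K ^ (1/2 : ℝ), ENNReal.rpow_lt_top_of_nonneg (by norm_num) hK.ne, ?_⟩
  intro F G H hF hG hH
  have hjm : Measurable jb := jb_cont.measurable
  set A : (ℝ × ℝ) × (ℝ × ℝ) → ℝ≥0∞ := fun q =>
    ENNReal.ofReal (|3 * (q.1.1 + q.2.1) ^ 2 - 2 * σ * q.2.1| ^ s *
      jb (q.1.2 + q.2.2 - (q.1.1 + q.2.1) ^ 3) ^ (-b) * jb (q.2.2 - σ * q.2.1 ^ 2) ^ (-(1/2 + ε))) with hA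
  have hAm : Measurable A := by fun_prop
  set F' : ℝ × ℝ → ℝ≥0∞ := fun p => ENNReal.ofReal (jb (p.2 - p.1 ^ 3) ^ b) * F p with hF'
  set H' : ℝ × ℝ → ℝ≥0∞ := fun p => ENNReal.ofReal (jb (p.2 - σ * p.1 ^ 2) ^ (1/2 + ε)) * H p with hH'
  have hF'm : Measurable F' := by fun_prop
  have hH'm : Measurable H' := by fun_prop
  have sqF : ∀ p, F' p ^ 2 = ENNReal.ofReal (jb (p.2 - p.1 ^ 3) ^ (2 * b)) * F p ^ 2 := by
    intro p
    simp only [hF', mul_pow]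
    rw [← ENNReal.ofReal_pow (by have := jb_pos (p.2 - p.1 ^ 3); positivity),
      ← Real.rpow_mul_natCast (jb_pos _).le]
    congr 3; push_cast; ring
  have sqH : ∀ p, H' p ^ 2 = ENNReal.ofReal (jb (p.2 - σ * p.1 ^ 2) ^ (2 * (1/2 + ε))) * H p ^ 2 := by
    intro p
    simp only [hH', mul_pow]
    rw [← ENNReal.ofReal_pow (by have := jb_pos (p.2 - σ * p.1 ^ 2); positivity),
      ← Real.rpow_mul_natCast (jb_pos _).le]
    congr 3; push_cast; ring
  simp_rw [← sqF, ← sqH]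
  have cs := ENNReal.lintegral_mul_le_Lp_mul_Lq (volume : Measure ((ℝ × ℝ) × (ℝ × ℝ)))
    Real.HolderConjugate.two_two
    (f := fun q => A q * G q.1) (g := fun q => F' (q.1 + q.2) * H' q.2)
    (by fun_prop) (by fun_prop)
  have e1 : ∫⁻ q : (ℝ × ℝ) × (ℝ × ℝ), (A q * G q.1) ^ (2 : ℝ) ≤ K * ∫⁻ p, G p ^ 2 := by
    rw [Measure.volume_eq_prod, lintegral_prod _ (by fun_prop), ← lintegral_const_mul' _ _ hK.ne]
    refine lintegral_mono fun q1 => ?_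
    simp only [ENNReal.rpow_ofNat, mul_pow]
    rw [lintegral_mul_const _ (by fun_prop)]
    gcongr
    refine le_trans (le_of_eq ?_) (hD q1.1 q1.2)
    refine lintegral_congr fun p => ?_
    have j1 := jb_pos (q1.2 + p.2 - (q1.1 + p.1) ^ 3)
    have j2 := jb_pos (p.2 - σ * p.1 ^ 2)
    simp only [hA]
    rw [← ENNReal.ofReal_pow (by positivity), ← ENNReal.ofReal_mul (by positivity)]
    congr 1
    rw [mul_pow, mul_pow, ← Real.rpow_mul_natCast (abs_nonneg _), ← Real.rpow_mul_natCast j1.le,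
      ← Real.rpow_mul_natCast j2.le, jb_rpow, jb_rpow]
    congr 3
    · push_cast; ring
    · congr 1; push_cast; ring
    · push_cast; ring
  have e2 : ∫⁻ q : (ℝ × ℝ) × (ℝ × ℝ), (F' (q.1 + q.2) * H' q.2) ^ (2 : ℝ) =
      (∫⁻ p, F' p ^ 2) * ∫⁻ p, H' p ^ 2 := by
    rw [Measure.volume_eq_prod, lintegral_prod_symm _ (by fun_prop)]
    simp only [ENNReal.rpow_ofNat, mul_pow]
    rw [← lintegral_const_mul _ (by fun_prop)]
    refine lintegral_congr fun p => ?_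
    rw [lintegral_mul_const _ (by fun_prop), lintegral_add_right_eq_self (fun p => F' p ^ 2) p]
  calc _ = ∫⁻ q, ((fun q : (ℝ × ℝ) × (ℝ × ℝ) => A q * G q.1) *
        (fun q : (ℝ × ℝ) × (ℝ × ℝ) => F' (q.1 + q.2) * H' q.2)) q := by
        refine lintegral_congr fun q => ?_
        simp only [Pi.mul_apply, hA, hF', hH', Prod.fst_add, Prod.snd_add]
        have j1 := jb_pos (q.1.2 + q.2.2 - (q.1.1 + q.2.1) ^ 3)
        have j2 := jb_pos (q.2.2 - σ * q.2.1 ^ 2)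
        have : |3 * (q.1.1 + q.2.1) ^ 2 - 2 * σ * q.2.1| ^ s =
          (|3 * (q.1.1 + q.2.1) ^ 2 - 2 * σ * q.2.1| ^ s *
          jb (q.1.2 + q.2.2 - (q.1.1 + q.2.1) ^ 3) ^ (-b) * jb (q.2.2 - σ * q.2.1 ^ 2) ^ (-(1/2 + ε))) *
          jb (q.1.2 + q.2.2 - (q.1.1 + q.2.1) ^ 3) ^ b * jb (q.2.2 - σ * q.2.1 ^ 2) ^ (1/2 + ε) := by
          rw [Real.rpow_neg j1.le, Real.rpow_neg j2.le]
          have k1 := (Real.rpow_pos_of_pos j1 b).ne'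
          have k2 := (Real.rpow_pos_of_pos j2 (1/2 + ε)).ne'
          generalize jb (q.1.2 + q.2.2 - (q.1.1 + q.2.1) ^ 3) ^ b = X at *
          generalize jb (q.2.2 - σ * q.2.1 ^ 2) ^ (1/2 + ε) = Y at *
          field_simp
        conv_lhs => rw [this]
        rw [ENNReal.ofReal_mul (by positivity), ENNReal.ofReal_mul (by positivity)]
        ring
    _ ≤ _ := cs
    _ ≤ (K * ∫⁻ p, G p ^ 2) ^ (1/2 : ℝ) * ((∫⁻ p, F' p ^ 2) * ∫⁻ p, H' p ^ 2) ^ (1/2 : ℝ) := by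
        rw [e2]; gcongr
    _ = _ := by
        rw [ENNReal.mul_rpow_of_nonneg _ _ (by norm_num), ENNReal.mul_rpow_of_nonneg _ _ (by norm_num)]
        ring

open FourierTransform in
lemma planch {E : Type*} [NormedAddCommGroup E] [InnerProductSpace ℝ E] [FiniteDimensional ℝ E]
    [MeasurableSpace E] [BorelSpace E] (g : E → ℂ) (h1 : Integrable g volume) (h2 : MemLp g 2 volume) :
    eLpNorm (𝓕 g) 2 volume = eLpNorm g 2 volume := by
  set u : Lp ℂ 2 (volume : Measure E) := h2.toLp g with hu
  have key : ∀ᵐ x, (𝓕 g) x = (𝓕 u : Lp ℂ 2 (volume : Measure E)) x := by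
    apply ae_eq_of_integral_contDiff_smul_eq
    · exact (VectorFourier.fourierIntegral_continuous Real.continuous_fourierChar
        (by exact continuous_inner) h1).locallyIntegrable
    · exact (Lp.memLp _).locallyIntegrable (by norm_num)
    · intro φ hφ hφc
      have hφ' : ContDiff ℝ (⊤ : ℕ∞) (fun x => (φ x : ℂ)) := Complex.ofRealCLM.contDiff.comp hφ
      have hφc' : HasCompactSupport (fun x => (φ x : ℂ)) := hφc.comp_left (g := fun y : ℝ => (y : ℂ)) (by simp)
      set Φ : SchwartzMap E ℂ := hφc'.toSchwartzMap hφ' with hΦ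
      have hΦv : ∀ x, Φ x = (φ x : ℂ) := fun x => rfl
      have t := congrArg (fun T => T Φ) (Lp.fourier_toTemperedDistribution_eq u)
      simp only [TemperedDistribution.fourier_apply, Lp.toTemperedDistribution_apply] at t
      have sw := VectorFourier.integral_fourierIntegral_smul_eq_flip (L := innerₗ E)
        (f := fun x => (Φ x)) (g := g) (μ := volume) (ν := volume) Real.continuous_fourierChar
        (by exact continuous_inner) Φ.integrable h1
      rw [flip_innerₗ] at sw
      calc ∫ x, φ x • (𝓕 g) x = ∫ x, Φ x • (𝓕 g) x := by
            simp [hΦv]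
        _ = ∫ x, (𝓕 Φ) x • g x := sw.symm
        _ = ∫ x, (𝓕 Φ) x • u x := by
            apply integral_congr_ae
            filter_upwards [h2.coeFn_toLp] with x hx
            rw [hu, hx]
        _ = _ := t
        _ = _ := by simp [hΦv]
  rw [eLpNorm_congr_ae key, ← eLpNorm_congr_ae h2.coeFn_toLp]
  have := Lp.norm_fourier_eq u
  rw [Lp.norm_def, Lp.norm_def] at this
  exact (ENNReal.toReal_eq_toReal_iff' (Lp.eLpNorm_ne_top _) (Lp.eLpNorm_ne_top _)).1 this

lemma ft2_norm_exp (p q : ℝ × ℝ) :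
    ‖Complex.exp (-(2 * Real.pi * (q.1 * p.1 + q.2 * p.2)) * Complex.I)‖ = 1 := by
  have := Complex.norm_exp_ofReal_mul_I (-(2 * Real.pi * (q.1 * p.1 + q.2 * p.2)))
  push_cast at this
  exact this

lemma ft2_zero {f : ℝ × ℝ → ℂ} (hf : ¬ Integrable f volume) : FT2 f = 0 := by
  funext p
  apply integral_undef
  intro h
  apply hf
  have h2 := h.bdd_smul (C := 1)
    (φ := fun q : ℝ × ℝ => Complex.exp (-(-(2 * Real.pi * (q.1 * p.1 + q.2 * p.2)) * Complex.I)))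
    (by apply Continuous.aestronglyMeasurable; fun_prop)
    (Filter.Eventually.of_forall fun q => by
      rw [Complex.exp_neg, norm_inv, ft2_norm_exp, inv_one])
  refine h2.congr (Filter.Eventually.of_forall fun q => ?_)
  simp only [Pi.smul_apply', smul_smul]
  rw [← Complex.exp_add]
  simp

lemma ft2_meas (f : ℝ × ℝ → ℂ) : Measurable (FT2 f) := by
  by_cases hf : Integrable f volume
  · apply Continuous.measurable
    unfold FT2
    apply continuous_of_dominated (bound := fun q => ‖f q‖)
    · intro p
      refine AEStronglyMeasurable.smul (f := fun q : ℝ × ℝ =>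
        Complex.exp (-(2 * Real.pi * (q.1 * p.1 + q.2 * p.2)) * Complex.I)) ?_ hf.aestronglyMeasurable
      exact Continuous.aestronglyMeasurable (by fun_prop)
    · intro p
      refine Filter.Eventually.of_forall fun q => ?_
      rw [norm_smul, ft2_norm_exp, one_mul]
    · exact hf.norm
    · refine Filter.Eventually.of_forall fun q => ?_
      fun_prop
  · rw [ft2_zero hf]; exact measurable_zero

open FourierTransform in
lemma ft2_planch (g : ℝ × ℝ → ℂ) :
    (∫⁻ p, ‖FT2 g p‖ₑ ^ 2) ^ (1/2 : ℝ) ≤ eLpNorm g 2 volume := by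
  have e0 : (∫⁻ p, ‖FT2 g p‖ₑ ^ 2) ^ (1/2 : ℝ) = eLpNorm (FT2 g) 2 volume := by
    rw [eLpNorm_eq_lintegral_rpow_enorm_toReal (by norm_num) (by norm_num)]
    simp
  rw [e0]
  by_cases hg : Integrable g volume
  swap
  · rw [ft2_zero hg]; simp
  by_cases hg2 : eLpNorm g 2 volume = ⊤
  · rw [hg2]; exact le_top
  have hm2 : MemLp g 2 volume := ⟨hg.aestronglyMeasurable, lt_top_iff_ne_top.2 hg2⟩
  have mp := WithLp.volume_preserving_symm_measurableEquiv_toLp_prod ℝ ℝ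
  set e := (MeasurableEquiv.toLp 2 (ℝ × ℝ)) with he
  have mp' : MeasurePreserving e := mp.symm
  have k1 : Integrable (g ∘ e.symm) volume := mp.integrable_comp_of_integrable hg
  have k2 : MemLp (g ∘ e.symm) 2 volume := hm2.comp_measurePreserving mp
  have hp := planch (g ∘ e.symm) k1 k2
  have hft : FT2 g = (𝓕 (g ∘ e.symm)) ∘ e := by
    funext p
    simp only [Function.comp_apply, FT2]
    rw [Real.fourier_eq', ← mp'.integral_comp e.measurableEmbedding]
    refine integral_congr_ae (Filter.Eventually.of_forall fun q => ?_)
    simp only [MeasurableEquiv.symm_apply_apply, Function.comp_apply]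
    congr 2
    simp [he, WithLp.prod_inner_apply]
    ring
  have r1 : eLpNorm ((𝓕 (g ∘ e.symm)) ∘ e) 2 volume = eLpNorm (𝓕 (g ∘ e.symm)) 2 volume := by
    apply eLpNorm_comp_measurePreserving _ mp'
    exact (VectorFourier.fourierIntegral_continuous Real.continuous_fourierChar
        (by exact continuous_inner) k1).aestronglyMeasurable
  rw [hft, r1, hp, eLpNorm_comp_measurePreserving hg.aestronglyMeasurable mp]

lemma xnorm_eq (φ : ℝ → ℝ) (b : ℝ) (f : ℝ × ℝ → ℂ) :
    XNorm φ 0 b f =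
      (∫⁻ p : ℝ × ℝ, ENNReal.ofReal (jb (p.2 + φ p.1) ^ (2 * b)) * ‖FT2 f p‖ₑ ^ 2) ^ (1/2 : ℝ) := by
  unfold XNorm
  congr 1
  refine lintegral_congr fun p => ?_
  have := jb_pos (p.2 + φ p.1)
  rw [mul_zero, Real.rpow_zero, one_mul, ENNReal.ofReal_mul (by positivity),
    ENNReal.ofReal_pow (norm_nonneg _), ofReal_norm]

lemma ofReal_quad {m : ℝ} {x y z : ℂ} (hm : 0 ≤ m) (hx : 0 ≤ x.re) (hy : 0 ≤ y.re) (hz : 0 ≤ z.re) :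
    ENNReal.ofReal (m * x.re * y.re * z.re) ≤ ENNReal.ofReal m * ‖x‖ₑ * ‖y‖ₑ * ‖z‖ₑ := by
  rw [← ofReal_norm, ← ofReal_norm, ← ofReal_norm, ← ENNReal.ofReal_mul hm,
    ← ENNReal.ofReal_mul (by positivity), ← ENNReal.ofReal_mul (by positivity)]
  apply ENNReal.ofReal_le_ofReal
  gcongr <;> exact Complex.re_le_norm _

/-- the interpolated trilinear estimates for `I^s_5` and `I^s_6`. -/
theorem stmt6 (s ρ ε : ℝ) (hs : s ∈ Set.Icc (0 : ℝ) (1/2))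
    (hρ : 2/9 + (5/9 : ℝ) * s ≤ ρ) (hε : 0 < ε) :
    ∃ C : ℝ, 0 < C ∧
      ∀ f g h : ℝ × ℝ → ℂ, HasNonnegFT f → HasNonnegFT g → HasNonnegFT h →
        (Itri (fun ξ₁ ξ₂ => |3 * (ξ₁ + ξ₂) ^ 2 - 2 * ξ₂| ^ s) (FT2 f) (FT2 g) (FT2 h) ≤
            ENNReal.ofReal C * XNorm AiryPhase 0 (ρ + ε) f * eLpNorm g 2 volume *
              XNorm SchPhaseNeg 0 (1/2 + ε) h) ∧
        (Itri (fun ξ₁ ξ₂ => |3 * (ξ₁ + ξ₂) ^ 2 + 2 * ξ₁| ^ s) (FT2 f) (FT2 g) (FT2 h) ≤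
            ENNReal.ofReal C * XNorm AiryPhase 0 (ρ + ε) f * XNorm SchPhase 0 (1/2 + ε) g *
              eLpNorm h 2 volume) := by
  obtain ⟨C₁, hC₁, h₁⟩ := lemE (s := s) (b := ρ + ε) (ε := ε) 1 hs hε (by linarith)
  obtain ⟨C₂, hC₂, h₂⟩ := lemE (s := s) (b := ρ + ε) (ε := ε) (-1) hs hε (by linarith)
  have hC : ENNReal.ofReal (C₁.toReal + C₂.toReal + 1) = C₁ + C₂ + 1 := by
    rw [ENNReal.ofReal_add (by positivity) (by norm_num), ENNReal.ofReal_add (by positivity)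
      (by positivity), ENNReal.ofReal_toReal hC₁.ne, ENNReal.ofReal_toReal hC₂.ne, ENNReal.ofReal_one]
  refine ⟨C₁.toReal + C₂.toReal + 1, by positivity, ?_⟩
  intro f g h hf hg hh
  rw [hC, xnorm_eq, xnorm_eq, xnorm_eq]
  have mF := (ft2_meas f).enorm
  have mG := (ft2_meas g).enorm
  have mH := (ft2_meas h).enorm
  constructor
  · have key := h₁ (fun p => ‖FT2 f p‖ₑ) (fun p => ‖FT2 g p‖ₑ) (fun p => ‖FT2 h p‖ₑ) mF mG mH
    have i1 : Itri (fun ξ₁ ξ₂ => |3 * (ξ₁ + ξ₂) ^ 2 - 2 * ξ₂| ^ s) (FT2 f) (FT2 g) (FT2 h) ≤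
        ∫⁻ q : (ℝ × ℝ) × (ℝ × ℝ), ENNReal.ofReal (|3 * (q.1.1 + q.2.1) ^ 2 - 2 * 1 * q.2.1| ^ s) *
          ‖FT2 f (q.1 + q.2)‖ₑ * ‖FT2 g q.1‖ₑ * ‖FT2 h q.2‖ₑ := by
      refine lintegral_mono fun q => ?_
      rw [mul_one]
      exact ofReal_quad (by positivity) (hf _).2 (hg _).2 (hh _).2
    refine i1.trans (key.trans ?_)
    have c1 : C₁ ≤ C₁ + C₂ + 1 := by rw [add_assoc]; exact le_self_add
    simp only [AiryPhase, SchPhaseNeg, one_mul, ← sub_eq_add_neg]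
    gcongr
    exact ft2_planch g
  · have key := h₂ (fun p => ‖FT2 f p‖ₑ) (fun p => ‖FT2 h p‖ₑ) (fun p => ‖FT2 g p‖ₑ) mF mH mG
    have i1 : Itri (fun ξ₁ ξ₂ => |3 * (ξ₁ + ξ₂) ^ 2 + 2 * ξ₁| ^ s) (FT2 f) (FT2 g) (FT2 h) ≤
        ∫⁻ q : (ℝ × ℝ) × (ℝ × ℝ), ENNReal.ofReal (|3 * (q.1.1 + q.2.1) ^ 2 - 2 * (-1) * q.2.1| ^ s) *
          ‖FT2 f (q.1 + q.2)‖ₑ * ‖FT2 h q.1‖ₑ * ‖FT2 g q.2‖ₑ := by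
      unfold Itri
      rw [Measure.volume_eq_prod, ← lintegral_prod_swap]
      refine lintegral_mono fun q => ?_
      simp only [Prod.fst_swap, Prod.snd_swap]
      refine (ofReal_quad (by positivity) (hf _).2 (hg _).2 (hh _).2).trans (le_of_eq ?_)
      have a1 : |3 * (q.2.1 + q.1.1) ^ 2 + 2 * q.2.1| = |3 * (q.1.1 + q.2.1) ^ 2 - 2 * (-1) * q.2.1| := by
        ring_nf
      have a2 : (q.2.1 + q.1.1, q.2.2 + q.1.2) = q.1 + q.2 := by
        ext <;> simp [add_comm]
      rw [a1, a2]; ring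
    refine i1.trans (key.trans ?_)
    have c1 : C₂ ≤ C₁ + C₂ + 1 := by rw [add_assoc, add_left_comm]; exact le_self_add
    simp only [AiryPhase, SchPhase, neg_mul, one_mul, ← sub_eq_add_neg, sub_neg_eq_add]
    rw [mul_right_comm]
    gcongr
    exact ft2_planch h

end
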